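/- arXiv:2111.06964 — 4 statements merged into one kernel-verified Lean document; each statement's English description precedes it below -/
import Mathlib

section
/- Let L ∈ ℝᴺˣᴺ be the Laplacian of a connected undirected graph, and let Q′, G ∈ ℝⁿˣⁿ be symmetric matrices that are simultaneously diagonalized by an orthogonal matrix T: Q′ = Tᵀ Δ_{Q′} T and G = Tᵀ Δ_G T, with Δ_{Q′} = diag(λ₁(Q′),…,λ_n(Q′)) and Δ_G = diag(λ₁(G),…,λ_n(G)). Let c ≥ 0 and let e ∈ ℝⁿᴺ be a stacked vector of blocks e₁,…,e_N ∈ ℝⁿ with Σᵢ eᵢ = 0, and set y = (I_N ⊗ T) e with blocks yᵢ = T eᵢ; for h = 1,…,n let y_{*,h} ∈ ℝᴺ collect the h-th components of y₁,…,y_N. If λ_h(G) ≥ 0 for all h, then eᵀ (I_N ⊗ Q′ − c L ⊗ G) e ≤ Σ_{h=1}^{n} ‖y_{*,h}‖² (λ_h(Q′) − c λ_h(G) λ₂(L)). -/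
open Matrix MeasureTheory
open scoped Kronecker

/-- Euclidean norm of a finite-dimensional real vector. -/
noncomputable def euclNorm {k : Type*} [Fintype k] (v : k → ℝ) : ℝ :=
  Real.sqrt (∑ i, (v i) ^ 2)

/-- Smallest eigenvalue of a symmetric matrix, via Rayleigh quotients. -/
noncomputable def lambdaMin {n : ℕ} (G : Matrix (Fin n) (Fin n) ℝ) : ℝ :=
  sInf {r : ℝ | ∃ v : Fin n → ℝ, v ≠ 0 ∧ v ⬝ᵥ G.mulVec v = r * ∑ i, (v i) ^ 2}

/-- Largest eigenvalue of a symmetric matrix, via Rayleigh quotients. -/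
noncomputable def lambdaMax {n : ℕ} (G : Matrix (Fin n) (Fin n) ℝ) : ℝ :=
  sSup {r : ℝ | ∃ v : Fin n → ℝ, v ≠ 0 ∧ v ⬝ᵥ G.mulVec v = r * ∑ i, (v i) ^ 2}

/-- Second-smallest eigenvalue of a connected-graph Laplacian, via Rayleigh
quotients over the zero-sum subspace (Courant–Fischer). -/
noncomputable def lambda2 {N : ℕ} (L : Matrix (Fin N) (Fin N) ℝ) : ℝ :=
  sInf {r : ℝ | ∃ v : Fin N → ℝ, v ≠ 0 ∧ (∑ i, v i) = 0 ∧
    v ⬝ᵥ L.mulVec v = r * ∑ i, (v i) ^ 2}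

/-- Spectral (ℓ²-operator) norm of a square matrix. -/
noncomputable def specNorm {n : ℕ} (Q : Matrix (Fin n) (Fin n) ℝ) : ℝ :=
  sSup {r : ℝ | ∃ v : Fin n → ℝ, euclNorm v = 1 ∧ r = euclNorm (Q.mulVec v)}

/-- `L` is the Laplacian matrix of a connected undirected graph: symmetric,
positive semidefinite, zero row sums, and `λ₂(L) > 0`. -/
def IsLaplacianConnected {N : ℕ} (L : Matrix (Fin N) (Fin N) ℝ) : Prop :=
  L.IsSymm ∧ (∀ v : Fin N → ℝ, 0 ≤ v ⬝ᵥ L.mulVec v) ∧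
    (∀ i, ∑ j, L i j = 0) ∧ 0 < lambda2 L

/-- The QUAD(P,Q) condition. -/
def QUAD {n : ℕ} (P Q : Matrix (Fin n) (Fin n) ℝ)
    (f : (Fin n → ℝ) → ℝ → (Fin n → ℝ)) : Prop :=
  ∀ x y : Fin n → ℝ, ∀ t : ℝ, 0 ≤ t →
    (x - y) ⬝ᵥ P.mulVec (f x t - f y t) ≤ (x - y) ⬝ᵥ Q.mulVec (x - y)

/-- The relaxed QUAD condition with matrices `P`, `Q` and vector `m`. -/
def RelaxedQUAD {n : ℕ} (P Q : Matrix (Fin n) (Fin n) ℝ) (m : Fin n → ℝ)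
    (f : (Fin n → ℝ) → ℝ → (Fin n → ℝ)) : Prop :=
  ∀ x y : Fin n → ℝ, ∀ t : ℝ, 0 ≤ t →
    (x - y) ⬝ᵥ P.mulVec (f x t - f y t) ≤
      (x - y) ⬝ᵥ Q.mulVec (x - y) + ∑ h, m h * |x h - y h|

/-- The coupling assumption on `g` with matrices `P`, `G` and gain `c`. -/
def CouplingAssumption {n : ℕ} (P G : Matrix (Fin n) (Fin n) ℝ) (c : ℝ)
    (g : (Fin n → ℝ) → (Fin n → ℝ) → ℝ → (Fin n → ℝ)) : Prop :=
  (∀ x : Fin n → ℝ, ∀ t : ℝ, 0 ≤ t → g x x t = 0) ∧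
  (∀ x y : Fin n → ℝ, ∀ t : ℝ, 0 ≤ t → g x y t = - g y x t) ∧
  (∀ x y : Fin n → ℝ, ∀ t : ℝ, 0 ≤ t →
    c * ((x - y) ⬝ᵥ G.mulVec (x - y)) ≤ (y - x) ⬝ᵥ P.mulVec (g x y t))

/-- Symmetric part of a matrix. -/
noncomputable def symPart {n : ℕ} (M : Matrix (Fin n) (Fin n) ℝ) :
    Matrix (Fin n) (Fin n) ℝ := (1 / 2 : ℝ) • (M + M.transpose)

/-- Componentwise sign of a vector, with `sign 0 = 0`. -/
noncomputable def signVec {n : ℕ} (v : Fin n → ℝ) : Fin n → ℝ :=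
  fun h => Real.sign (v h)

/-- The quadratic form of a Kronecker product on stacked vectors, in blocks. -/
theorem dotProduct_kronecker_mulVec_stacked {ι κ : Type*} [Fintype ι] [Fintype κ]
    (A : Matrix ι ι ℝ) (B : Matrix κ κ ℝ) (e : ι → κ → ℝ) :
    (fun p : ι × κ => e p.1 p.2) ⬝ᵥ ((A ⊗ₖ B).mulVec (fun p : ι × κ => e p.1 p.2)) =
      ∑ i, ∑ j, A i j * (e i ⬝ᵥ B.mulVec (e j)) := by
  simp only [dotProduct, mulVec, kroneckerMap_apply, Fintype.sum_prod_type, Finset.mul_sum]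
  refine Finset.sum_congr rfl fun i _ => ?_
  rw [Finset.sum_comm]
  refine Finset.sum_congr rfl fun j _ => Finset.sum_congr rfl fun a _ =>
    Finset.sum_congr rfl fun b _ => ?_
  ring

theorem dotProduct_transpose_diagonal_mulVec {κ : Type*} [Fintype κ] [DecidableEq κ]
    (T : Matrix κ κ ℝ) (d u v : κ → ℝ) :
    u ⬝ᵥ (Tᵀ * diagonal d * T).mulVec v = ∑ h, d h * (T.mulVec u h * T.mulVec v h) := by
  rw [← mulVec_mulVec, ← mulVec_mulVec, dotProduct_mulVec, vecMul_transpose]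
  simp only [dotProduct, mulVec_diagonal]
  exact Finset.sum_congr rfl fun h _ => by ring

/-- If the second factor is diagonalized by `T`, the quadratic form of a Kronecker product on
stacked vectors decouples along the components of the transformed blocks. -/
theorem dotProduct_kronecker_diagonalized {ι κ : Type*} [Fintype ι] [Fintype κ] [DecidableEq κ]
    (A : Matrix ι ι ℝ) (T : Matrix κ κ ℝ) (d : κ → ℝ) (e : ι → κ → ℝ) :
    (fun p : ι × κ => e p.1 p.2) ⬝ᵥ
        ((A ⊗ₖ (Tᵀ * diagonal d * T)).mulVec (fun p : ι × κ => e p.1 p.2)) =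
      ∑ h, d h * ((fun i => T.mulVec (e i) h) ⬝ᵥ A.mulVec (fun i => T.mulVec (e i) h)) := by
  simp only [dotProduct_kronecker_mulVec_stacked, dotProduct_transpose_diagonal_mulVec]
  simp only [dotProduct, mulVec.eq_1 A, Finset.mul_sum]
  symm
  rw [Finset.sum_comm]
  refine Finset.sum_congr rfl fun i _ => ?_
  rw [Finset.sum_comm]
  refine Finset.sum_congr rfl fun j _ => Finset.sum_congr rfl fun h _ => ?_
  ring

theorem lambda2_mul_le_dotProduct_mulVec {N : ℕ} {L : Matrix (Fin N) (Fin N) ℝ}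
    (hL : ∀ v : Fin N → ℝ, 0 ≤ v ⬝ᵥ L.mulVec v) {v : Fin N → ℝ} (hv : ∑ i, v i = 0) :
    lambda2 L * ∑ i, (v i) ^ 2 ≤ v ⬝ᵥ L.mulVec v := by
  have sum_sq_pos : ∀ w : Fin N → ℝ, w ≠ 0 → 0 < ∑ i, (w i) ^ 2 := fun w hw => by
    obtain ⟨i, hi⟩ := Function.ne_iff.mp hw
    exact Finset.sum_pos' (fun j _ => sq_nonneg _) ⟨i, Finset.mem_univ i, sq_pos_of_ne_zero hi⟩
  rcases eq_or_ne v 0 with rfl | hv0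
  · simp
  rw [← le_div_iff₀ (sum_sq_pos v hv0)]
  refine csInf_le ⟨0, ?_⟩ ⟨v, hv0, hv, (div_mul_cancel₀ _ (sum_sq_pos v hv0).ne').symm⟩
  rintro r ⟨w, hw0, -, hw⟩
  exact nonneg_of_mul_nonneg_left (hw ▸ hL w) (sum_sq_pos w hw0)

theorem euclNorm_sq {κ : Type*} [Fintype κ] (v : κ → ℝ) : euclNorm v ^ 2 = ∑ i, (v i) ^ 2 :=
  Real.sq_sqrt (Finset.sum_nonneg fun _ _ => sq_nonneg _)

/-- The Kronecker-product quadratic-form bound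
`eᵀ (I_N ⊗ Q′ − c L ⊗ G) e ≤ Σ_h ‖y_{*,h}‖² (λ_h(Q′) − c λ_h(G) λ₂(L))`
for zero-sum stacked vectors `e`, where `y = (I_N ⊗ T) e`. -/
theorem kronecker_quadratic_form_bound
    {n N : ℕ} (hn : 0 < n) (hN : 2 ≤ N)
    (L : Matrix (Fin N) (Fin N) ℝ) (hL : IsLaplacianConnected L)
    (Q' G T : Matrix (Fin n) (Fin n) ℝ)
    (hQ'sym : Q'.IsSymm) (hGsym : G.IsSymm)
    (hT : T.transpose * T = 1)
    (μ ν : Fin n → ℝ)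
    (hQ'diag : Q' = T.transpose * Matrix.diagonal μ * T)
    (hGdiag : G = T.transpose * Matrix.diagonal ν * T)
    (hν : ∀ h, 0 ≤ ν h)
    (c : ℝ) (hc0 : 0 ≤ c)
    (e : Fin N → (Fin n → ℝ)) (hsum : ∑ i, e i = 0)
    (y : Fin N → (Fin n → ℝ)) (hy : ∀ i, y i = T.mulVec (e i)) :
    (fun p : Fin N × Fin n => e p.1 p.2) ⬝ᵥ
        (((1 : Matrix (Fin N) (Fin N) ℝ) ⊗ₖ Q' - c • (L ⊗ₖ G)).mulVec
          (fun p : Fin N × Fin n => e p.1 p.2))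
      ≤ ∑ h, (euclNorm (fun i => y i h)) ^ 2 * (μ h - c * ν h * lambda2 L) := by
  obtain ⟨-, hpsd, -, -⟩ := hL
  have hzero : ∀ h, ∑ i, T.mulVec (e i) h = 0 := fun h => by
    rw [← Finset.sum_apply, ← Matrix.mulVec_sum, hsum, mulVec_zero, Pi.zero_apply]
  rw [sub_mulVec, smul_mulVec, dotProduct_sub, dotProduct_smul, hQ'diag, hGdiag,
    dotProduct_kronecker_diagonalized, dotProduct_kronecker_diagonalized, smul_eq_mul,
    Finset.mul_sum, ← Finset.sum_sub_distrib]
  refine Finset.sum_le_sum fun h _ => ?_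
  have hR := mul_le_mul_of_nonneg_left (lambda2_mul_le_dotProduct_mulVec hpsd (hzero h))
    (mul_nonneg hc0 (hν h))
  simp only [hy, euclNorm_sq, one_mulVec]
  have hsq : (fun i => T.mulVec (e i) h) ⬝ᵥ (fun i => T.mulVec (e i) h) =
      ∑ i, (T.mulVec (e i) h) ^ 2 :=
    Finset.sum_congr rfl fun i _ => (sq _).symm
  rw [hsq]
  linarith
end

section
/- Consider two coupled agents ẋ₁ = f(x₁,t) + c Γ (x₂ − x₁) + c_d Γ_d sign(x₂ − x₁) and ẋ₂ = f(x₂,t) + c Γ (x₁ − x₂) + c_d Γ_d sign(x₁ − x₂), where sign acts componentwise. Assume there exist P, Q, Q⁻, Q′ ∈ ℝⁿˣⁿ and m ∈ ℝⁿ with P symmetric positive definite, Q = Q⁻ + Q′, Q⁻ negative definite, Q′ symmetric, m ≠ 0, such that: f satisfies the relaxed QUAD condition with P, Q, m; Q′ and G := PΓ (assumed symmetric) are simultaneously diagonalized by an orthogonal matrix T, Q′ = Tᵀ Δ_{Q′} T and G = Tᵀ Δ_G T with eigenvalues λ_h(Q′), λ_h(G) ≥ 0 in the common ordering; λ_h(G)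 > 0 whenever λ_h(Q′) > 0; PΓ_d = diag(γ_{d,1},…,γ_{d,n}) with γ_{d,h} ≥ 0 and γ_{d,h} > 0 whenever m_h > 0. If c > 0 satisfies λ_h(Q′) − 2c λ_h(G) ≤ 0 for all h with strict inequality whenever λ_h(Q′) > 0, and c_d ≥ 0 satisfies m_h − 2 c_d γ_{d,h} ≤ 0 for all h, then the pair globally synchronizes: for every solution (locally absolutely continuous x₁, x₂ satisfying the equations for almost every t), ‖x₁(t) − x₂(t)‖ → 0 as t → ∞. -/
open Matrix MeasureTheory
open scoped Kronecker

/-- A positive definite quadratic form dominates a positive multiple of any other quadratic form. -/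
lemma Matrix.PosDef.exists_pos_mul_dotProduct_mulVec_le {ι : Type*} [Fintype ι]
    {M : Matrix ι ι ℝ} (hM : M.PosDef) (N : Matrix ι ι ℝ) :
    ∃ a : ℝ, 0 < a ∧ ∀ v : ι → ℝ, a * (v ⬝ᵥ N *ᵥ v) ≤ v ⬝ᵥ M *ᵥ v := by
  have hcont (A : Matrix ι ι ℝ) : Continuous fun v : ι → ℝ => v ⬝ᵥ A *ᵥ v := by fun_prop
  have hpos (v : ι → ℝ) (hv : v ≠ 0) : 0 < v ⬝ᵥ M *ᵥ v := by
    simpa using hM.dotProduct_mulVec_pos hv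
  have hK : IsCompact (Metric.sphere (0 : ι → ℝ) 1) := isCompact_sphere _ _
  obtain ⟨δ, hδ, hδM⟩ : ∃ δ : ℝ, 0 < δ ∧ ∀ u ∈ Metric.sphere (0 : ι → ℝ) 1,
      δ ≤ u ⬝ᵥ M *ᵥ u :=
    hK.exists_forall_le' (hcont M).continuousOn
      fun u hu => hpos u (ne_zero_of_mem_unit_sphere ⟨u, hu⟩)
  obtain ⟨B, hB⟩ := hK.exists_bound_of_continuousOn (hcont N).continuousOn
  have hb : 0 < max B 1 := lt_max_of_lt_right one_pos
  refine ⟨δ / max B 1, by positivity, fun v => ?_⟩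
  rcases eq_or_ne v 0 with rfl | hv
  · simp
  have hv' : ‖v‖ ≠ 0 := norm_ne_zero_iff.2 hv
  set u := ‖v‖⁻¹ • v with hu
  have hus : u ∈ Metric.sphere (0 : ι → ℝ) 1 := by
    simp [hu, norm_smul, hv']
  have hvu : v = ‖v‖ • u := by simp [hu, smul_smul, hv']
  have key : δ / max B 1 * (u ⬝ᵥ N *ᵥ u) ≤ u ⬝ᵥ M *ᵥ u := by
    calc δ / max B 1 * (u ⬝ᵥ N *ᵥ u) ≤ δ / max B 1 * max B 1 := by
          gcongr
          exact (le_abs_self _).trans ((hB u hus).trans (le_max_left _ _))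
      _ = δ := by field_simp
      _ ≤ _ := hδM u hus
  have hscale (A : Matrix ι ι ℝ) : v ⬝ᵥ A *ᵥ v = ‖v‖ ^ 2 * (u ⬝ᵥ A *ᵥ u) := by
    conv_lhs => rw [hvu]
    simp only [mulVec_smul, smul_dotProduct, dotProduct_smul, smul_eq_mul]
    ring
  rw [hscale, hscale]
  nlinarith [mul_le_mul_of_nonneg_left key (sq_nonneg ‖v‖)]

namespace AbsolutelyContinuousOnInterval

lemma le_of_ae_deriv_nonpos {g : ℝ → ℝ} {a b : ℝ} (hab : a ≤ b)
    (hg : AbsolutelyContinuousOnInterval g a b)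
    (hg' : ∀ᵐ t, t ∈ Set.Ioc a b → deriv g t ≤ 0) : g b ≤ g a := by
  have h : ∫ t in a..b, deriv g t ≤ 0 := by
    rw [intervalIntegral.integral_of_le hab]
    exact integral_nonpos_of_ae ((ae_restrict_iff' measurableSet_Ioc).2 hg')
  linarith [hg.integral_deriv_eq_sub]

lemma const (a b r : ℝ) : AbsolutelyContinuousOnInterval (fun _ : ℝ => r) a b :=
  ContDiffOn.absolutelyContinuousOnInterval contDiffOn_const

lemma congr {g₁ g₂ : ℝ → ℝ} {a b : ℝ} (hg : AbsolutelyContinuousOnInterval g₁ a b)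
    (h : Set.EqOn g₁ g₂ (Set.uIcc a b)) : AbsolutelyContinuousOnInterval g₂ a b := by
  rw [absolutelyContinuousOnInterval_iff] at hg ⊢
  intro ε hε
  obtain ⟨δ, hδ, H⟩ := hg ε hε
  refine ⟨δ, hδ, fun E hE hlen => ?_⟩
  convert H E hE hlen using 1
  refine Finset.sum_congr rfl fun i hi => ?_
  rw [h (hE.1 i hi).1, h (hE.1 i hi).2]

lemma finset_sum {ι : Type*} (s : Finset ι) {g : ι → ℝ → ℝ} {a b : ℝ}
    (hg : ∀ i ∈ s, AbsolutelyContinuousOnInterval (g i) a b) :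
    AbsolutelyContinuousOnInterval (fun t => ∑ i ∈ s, g i t) a b := by
  classical
  induction s using Finset.induction_on with
  | empty => simpa using const a b 0
  | insert i s hi ih =>
    simp only [Finset.sum_insert hi]
    exact (hg i (by simp)).fun_add (ih fun j hj => hg j (by simp [hj]))

lemma dotProduct_mulVec {ι : Type*} [Fintype ι] (P : Matrix ι ι ℝ) {X : ℝ → ι → ℝ} {a b : ℝ}
    (hX : ∀ i, AbsolutelyContinuousOnInterval (fun t => X t i) a b) :
    AbsolutelyContinuousOnInterval (fun t => X t ⬝ᵥ P *ᵥ X t) a b :=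
  finset_sum _ fun i _ => (hX i).fun_mul <| finset_sum _ fun j _ => (hX j).const_mul _

end AbsolutelyContinuousOnInterval

lemma HasDerivAt.dotProduct_mulVec {ι : Type*} [Fintype ι] {P : Matrix ι ι ℝ} (hP : P.IsSymm)
    {X : ℝ → ι → ℝ} {X' : ι → ℝ} {t : ℝ} (hX : HasDerivAt X X' t) :
    HasDerivAt (fun s => X s ⬝ᵥ P *ᵥ X s) (2 * (X t ⬝ᵥ P *ᵥ X')) t := by
  have h (i : ι) : HasDerivAt (fun s => X s i) (X' i) t := hasDerivAt_pi.1 hX i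
  have h1 : HasDerivAt (fun s => X s ⬝ᵥ P *ᵥ X s)
      (∑ i, (X' i * (P *ᵥ X t) i + X t i * (P *ᵥ X') i)) t :=
    HasDerivAt.fun_sum fun i _ => (h i).fun_mul <|
      HasDerivAt.fun_sum fun j _ => (h j).const_mul (P i j)
  convert h1 using 1
  have h2 : X' ⬝ᵥ P *ᵥ X t = X t ⬝ᵥ P *ᵥ X' := by
    rw [Matrix.dotProduct_mulVec, dotProduct_comm, ← mulVec_transpose, hP.eq]
  rw [Finset.sum_add_distrib, two_mul]
  exact congrArg (· + _) h2.symm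

/-- Exponential decay of a quadratic Lyapunov function along a Carathéodory trajectory. -/
lemma dotProduct_mulVec_le_exp_mul {ι : Type*} [Fintype ι] {P : Matrix ι ι ℝ} (hP : P.IsSymm)
    {X d : ℝ → ι → ℝ} {κ T : ℝ} (hT : 0 ≤ T) (hd : IntervalIntegrable d volume 0 T)
    (hX : ∀ t, X t = X 0 + ∫ s in (0 : ℝ)..t, d s)
    (hdec : ∀ᵐ t, t ∈ Set.Ioc 0 T → 2 * (X t ⬝ᵥ P *ᵥ d t) ≤ -κ * (X t ⬝ᵥ P *ᵥ X t)) :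
    X T ⬝ᵥ P *ᵥ X T ≤ Real.exp (-κ * T) * (X 0 ⬝ᵥ P *ᵥ X 0) := by
  have hac (i : ι) : AbsolutelyContinuousOnInterval (fun t => X t i) 0 T := by
    have hdi : IntervalIntegrable (fun t => d t i) volume 0 T :=
      ⟨hd.1.eval i, hd.2.eval i⟩
    refine ((AbsolutelyContinuousOnInterval.const 0 T (X 0 i)).fun_add
      (hdi.absolutelyContinuousOnInterval_intervalIntegral (c := 0) (by simp))).congr
      fun t ht => ?_
    have hdt : IntervalIntegrable d volume 0 t :=
      hd.mono_set (Set.uIcc_subset_uIcc Set.left_mem_uIcc ht)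
    have hcomp :=
      (ContinuousLinearMap.proj (R := ℝ) (φ := fun _ : ι => ℝ) i).intervalIntegral_comp_comm hdt
    simp only [ContinuousLinearMap.proj_apply] at hcomp
    simp only [hcomp]
    exact (congrFun (hX t) i).symm
  have hexp : AbsolutelyContinuousOnInterval (fun t => Real.exp (κ * t)) 0 T :=
    ContDiffOn.absolutelyContinuousOnInterval (by fun_prop)
  have hprod := hexp.fun_mul (AbsolutelyContinuousOnInterval.dotProduct_mulVec P hac)
  have hle := hprod.le_of_ae_deriv_nonpos hT (by
      filter_upwards [hd.ae_hasDerivAt_integral, hdec] with t ht htdec hmem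
      have hX' : HasDerivAt X (d t) t := by
        have hmem' : t ∈ Set.uIcc 0 T := by
          rw [Set.uIcc_of_le hT]
          exact ⟨hmem.1.le, hmem.2⟩
        have := (ht hmem' 0 (by simp)).const_add (X 0)
        rwa [← funext hX] at this
      have he : HasDerivAt (fun s => Real.exp (κ * s)) (Real.exp (κ * t) * κ) t := by
        simpa using ((hasDerivAt_id t).const_mul κ).exp
      rw [(he.fun_mul (hX'.dotProduct_mulVec hP)).deriv]
      nlinarith [mul_le_mul_of_nonneg_left (htdec hmem) (Real.exp_pos (κ * t)).le])
  simp only [mul_zero, Real.exp_zero, one_mul] at hle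
  calc X T ⬝ᵥ P *ᵥ X T
      = Real.exp (-κ * T) * (Real.exp (κ * T) * (X T ⬝ᵥ P *ᵥ X T)) := by
        rw [← mul_assoc, ← Real.exp_add]; simp
    _ ≤ _ := by gcongr

/-- Two agents with linear-plus-discontinuous coupling globally
synchronize when `f` satisfies the relaxed QUAD condition with `Q = Q⁻ + Q′`,
`Q⁻ ≺ 0`, `Q′` and `G = PΓ` symmetric and simultaneously diagonalized by an
orthogonal `T` (with `λ_h(G) ≥ 0`, and `λ_h(G) > 0` whenever `λ_h(Q′) > 0`),
`PΓ_d = diag(γ_d) ⪰ 0` with `γ_{d,h} > 0` whenever `m_h > 0`, provided `c > 0`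
satisfies `λ_h(Q′) − 2c λ_h(G) ≤ 0` (strict whenever `λ_h(Q′) > 0`) and
`c_d ≥ 0` satisfies `m_h − 2 c_d γ_{d,h} ≤ 0`. -/
theorem two_agents_discontinuous_coupling_indefinite_G_global_synchronization
    {n : ℕ} (hn : 0 < n)
    (f : (Fin n → ℝ) → ℝ → (Fin n → ℝ))
    (P Q Qm Q' Γ Γd T : Matrix (Fin n) (Fin n) ℝ)
    (m γd : Fin n → ℝ) (c cd : ℝ)
    (hP : P.PosDef) (hm : m ≠ 0)
    (hQ : Q = Qm + Q') (hQm : (-Qm).PosDef) (hQ'sym : Q'.IsSymm)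
    (hGsym : (P * Γ).IsSymm)
    (hf : RelaxedQUAD P Q m f)
    (hT : T.transpose * T = 1)
    (μ ν : Fin n → ℝ)
    (hQ'diag : Q' = T.transpose * Matrix.diagonal μ * T)
    (hGdiag : P * Γ = T.transpose * Matrix.diagonal ν * T)
    (hν : ∀ h, 0 ≤ ν h) (hνpos : ∀ h, 0 < μ h → 0 < ν h)
    (hPΓd : P * Γd = Matrix.diagonal γd)
    (hγd0 : ∀ h, 0 ≤ γd h) (hγdpos : ∀ h, 0 < m h → 0 < γd h)
    (hc0 : 0 < c)
    (hgain : ∀ h, μ h - 2 * c * ν h ≤ 0)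
    (hgain' : ∀ h, 0 < μ h → μ h - 2 * c * ν h < 0)
    (hcd0 : 0 ≤ cd) (hcd : ∀ h, m h - 2 * cd * γd h ≤ 0)
    (x1 x2 : ℝ → (Fin n → ℝ))
    (hx1 : ∃ d : ℝ → (Fin n → ℝ),
      (∀ t : ℝ, 0 ≤ t → IntervalIntegrable d volume 0 t) ∧
      (∀ᵐ t ∂(volume.restrict (Set.Ici (0 : ℝ))),
        d t = f (x1 t) t + c • Γ.mulVec (x2 t - x1 t)
            + cd • Γd.mulVec (signVec (x2 t - x1 t))) ∧
      (∀ t : ℝ, 0 ≤ t → x1 t = x1 0 + ∫ s in (0 : ℝ)..t, d s))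
    (hx2 : ∃ d : ℝ → (Fin n → ℝ),
      (∀ t : ℝ, 0 ≤ t → IntervalIntegrable d volume 0 t) ∧
      (∀ᵐ t ∂(volume.restrict (Set.Ici (0 : ℝ))),
        d t = f (x2 t) t + c • Γ.mulVec (x1 t - x2 t)
            + cd • Γd.mulVec (signVec (x1 t - x2 t))) ∧
      (∀ t : ℝ, 0 ≤ t → x2 t = x2 0 + ∫ s in (0 : ℝ)..t, d s)) :
    Filter.Tendsto (fun t => euclNorm (x1 t - x2 t)) Filter.atTop (nhds 0) := by
  have hPs : P.IsSymm := by simpa [Matrix.IsHermitian, Matrix.IsSymm] using hP.isHermitian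
  have hquad (D : Fin n → ℝ) (v : Fin n → ℝ) :
      v ⬝ᵥ (Tᵀ * diagonal D * T) *ᵥ v = ∑ h, D h * (T *ᵥ v) h ^ 2 := by
    rw [← mulVec_mulVec, ← mulVec_mulVec, Matrix.dotProduct_mulVec, vecMul_transpose]
    simp only [dotProduct, mulVec_diagonal]
    exact Finset.sum_congr rfl fun h _ => by ring
  have hsign (v : Fin n → ℝ) :
      v ⬝ᵥ diagonal γd *ᵥ signVec v = ∑ h, γd h * |v h| := by
    simp only [dotProduct, mulVec_diagonal, signVec]
    refine Finset.sum_congr rfl fun h _ => ?_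
    have habs : v h * Real.sign (v h) = |v h| := by
      rcases lt_trichotomy (v h) 0 with hv | hv | hv
      · simp [Real.sign_of_neg hv, abs_of_neg hv]
      · simp [hv]
      · simp [Real.sign_of_pos hv, abs_of_pos hv]
    rw [← habs]
    ring
  have hsignneg (v : Fin n → ℝ) : signVec (-v) = -signVec v := by
    funext h
    simp [signVec, Real.sign_neg]
  obtain ⟨d1, hd1, hode1, hint1⟩ := hx1
  obtain ⟨d2, hd2, hode2, hint2⟩ := hx2
  obtain ⟨κ, hκ, hκP⟩ := hQm.exists_pos_mul_dotProduct_mulVec_le P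
  obtain ⟨a, ha, haP⟩ := hP.exists_pos_mul_dotProduct_mulVec_le 1
  set X : ℝ → Fin n → ℝ := fun t => (x1 0 - x2 0) + ∫ s in (0 : ℝ)..t, (d1 s - d2 s) with hXdef
  have hX0 : X 0 = x1 0 - x2 0 := by simp [hXdef]
  have hXt (t : ℝ) (ht : 0 ≤ t) : X t = x1 t - x2 t := by
    rw [hint1 t ht, hint2 t ht, hXdef]
    simp only [intervalIntegral.integral_sub (hd1 t ht) (hd2 t ht)]
    abel
  have hdiss : ∀ᵐ t ∂(volume.restrict (Set.Ici (0 : ℝ))),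
      2 * (X t ⬝ᵥ P *ᵥ (d1 t - d2 t)) ≤ -(2 * κ) * (X t ⬝ᵥ P *ᵥ X t) := by
    filter_upwards [hode1, hode2, ae_restrict_mem measurableSet_Ici] with t h1 h2 ht
    have hq := hf (x1 t) (x2 t) t ht
    rw [h1, h2, hXt t ht, ← neg_sub (x1 t) (x2 t), hsignneg]
    simp only [← Pi.sub_apply (x1 t) (x2 t)] at hq
    generalize x1 t - x2 t = e at hq ⊢
    have hsplit : f (x1 t) t + c • Γ *ᵥ (-e) + cd • Γd *ᵥ (-signVec e)
        - (f (x2 t) t + c • Γ *ᵥ e + cd • Γd *ᵥ signVec e)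
        = (f (x1 t) t - f (x2 t) t) - (2 * c) • Γ *ᵥ e - (2 * cd) • Γd *ᵥ signVec e := by
      simp only [mulVec_neg, smul_neg, mul_smul, two_smul]
      abel
    have hlin : e ⬝ᵥ P *ᵥ ((f (x1 t) t - f (x2 t) t) - (2 * c) • Γ *ᵥ e
          - (2 * cd) • Γd *ᵥ signVec e)
        = e ⬝ᵥ P *ᵥ (f (x1 t) t - f (x2 t) t) - 2 * c * ∑ h, ν h * (T *ᵥ e) h ^ 2
          - 2 * cd * ∑ h, γd h * |e h| := by
      rw [mulVec_sub, mulVec_sub, mulVec_smul, mulVec_smul, mulVec_mulVec, mulVec_mulVec,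
        hPΓd, hGdiag, dotProduct_sub, dotProduct_sub, dotProduct_smul, dotProduct_smul, hquad,
        hsign, smul_eq_mul, smul_eq_mul]
    have hQe : e ⬝ᵥ Q *ᵥ e = e ⬝ᵥ Qm *ᵥ e + ∑ h, μ h * (T *ᵥ e) h ^ 2 := by
      rw [hQ, add_mulVec, dotProduct_add, hQ'diag, hquad]
    have hμν : ∑ h, μ h * (T *ᵥ e) h ^ 2 ≤ 2 * c * ∑ h, ν h * (T *ᵥ e) h ^ 2 := by
      rw [Finset.mul_sum]
      exact Finset.sum_le_sum fun h _ => by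
        nlinarith [mul_le_mul_of_nonneg_right (hgain h) (sq_nonneg ((T *ᵥ e) h))]
    have hmγ : ∑ h, m h * |e h| ≤ 2 * cd * ∑ h, γd h * |e h| := by
      rw [Finset.mul_sum]
      exact Finset.sum_le_sum fun h _ => by
        nlinarith [mul_le_mul_of_nonneg_right (hcd h) (abs_nonneg (e h))]
    have hκe := hκP e
    rw [neg_mulVec, dotProduct_neg] at hκe
    rw [hsplit, hlin]
    linarith
  have hdecay (t : ℝ) (ht : 0 ≤ t) :
      ∑ i, (x1 t - x2 t) i ^ 2 ≤ Real.exp (-(2 * κ) * t) * (X 0 ⬝ᵥ P *ᵥ X 0) / a := by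
    have h1 := dotProduct_mulVec_le_exp_mul hPs ht ((hd1 t ht).sub (hd2 t ht))
      (X := X) (κ := 2 * κ) (fun s => by rw [hX0]) (by
        filter_upwards [(ae_restrict_iff' measurableSet_Ici).1 hdiss] with s hs hmem
        exact hs hmem.1.le)
    have h2 := haP (X t)
    rw [one_mulVec, hXt t ht] at h2
    rw [hXt t ht] at h1
    rw [le_div_iff₀' ha]
    simp only [dotProduct, ← sq] at h2 ⊢
    exact h2.trans h1
  have hexp : Filter.Tendsto (fun t : ℝ => Real.exp (-(2 * κ) * t) * (X 0 ⬝ᵥ P *ᵥ X 0) / a)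
      Filter.atTop (nhds 0) := by
    have h0 : Filter.Tendsto (fun t : ℝ => Real.exp (-(2 * κ) * t)) Filter.atTop (nhds 0) :=
      Real.tendsto_exp_atBot.comp
        (Filter.tendsto_id.const_mul_atTop_of_neg (by linarith))
    simpa using (h0.mul_const _).div_const a
  have hsq : Filter.Tendsto (fun t => ∑ i, (x1 t - x2 t) i ^ 2) Filter.atTop (nhds 0) :=
    squeeze_zero' (Filter.Eventually.of_forall fun t => Finset.sum_nonneg fun i _ => sq_nonneg _)
      ((Filter.eventually_ge_atTop 0).mono hdecay) hexp
  simpa [euclNorm] using hsq.sqrt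
end

section
/- Let L ∈ ℝᴺˣᴺ be a symmetric matrix with zero row sums and nonpositive off-diagonal entries (a graph Laplacian), let P, G ∈ ℝⁿˣⁿ with G symmetric, let c ≥ 0, and let g : ℝⁿ × ℝⁿ × [0,∞) → ℝⁿ satisfy the coupling assumption with P, G, c. Then for all x₁,…,x_N ∈ ℝⁿ and t ≥ 0, writing x̄ = (1/N) Σᵢ xᵢ and eᵢ = xᵢ − x̄: − Σᵢ Σⱼ Lᵢⱼ eᵢᵀ P g(xᵢ, xⱼ, t) ≤ − c Σᵢ Σⱼ Lᵢⱼ eᵢᵀ G eⱼ. -/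
open Matrix MeasureTheory
open scoped Kronecker

/-- Pairing a symmetric weight with an arbitrary kernel only sees the symmetrized kernel. -/
theorem two_mul_sum_symm_mul {ι : Type*} [Fintype ι] {L : Matrix ι ι ℝ} (hL : L.IsSymm)
    (f : ι → ι → ℝ) :
    2 * ∑ i, ∑ j, L i j * f i j = ∑ i, ∑ j, L i j * (f i j + f j i) := by
  have hswap : ∑ i, ∑ j, L i j * f i j = ∑ i, ∑ j, L i j * f j i := by
    rw [Finset.sum_comm]
    simp only [hL.apply]
  simp only [mul_add, Finset.sum_add_distrib, ← hswap, two_mul]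

/-- The polarization identity for a symmetric weight with zero row sums. -/
theorem two_mul_sum_laplacian_mul_bilin {ι κ : Type*} [Fintype ι] [Fintype κ]
    {L : Matrix ι ι ℝ} (hL : L.IsSymm) (hrow : ∀ i, ∑ j, L i j = 0)
    (G : Matrix κ κ ℝ) (e : ι → κ → ℝ) :
    2 * ∑ i, ∑ j, L i j * (e i ⬝ᵥ G.mulVec (e j)) =
      -∑ i, ∑ j, L i j * ((e i - e j) ⬝ᵥ G.mulVec (e i - e j)) := by
  have hdiag : ∑ i, ∑ j, L i j * (e i ⬝ᵥ G.mulVec (e i)) = 0 := by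
    simp only [← Finset.sum_mul, hrow, zero_mul, Finset.sum_const_zero]
  have hsymm := two_mul_sum_symm_mul hL fun i _ => e i ⬝ᵥ G.mulVec (e i)
  rw [hdiag, mul_zero] at hsymm
  rw [two_mul_sum_symm_mul hL, eq_neg_iff_add_eq_zero, hsymm]
  simp only [← Finset.sum_add_distrib]
  refine Finset.sum_congr rfl fun i _ => Finset.sum_congr rfl fun j _ => ?_
  simp only [mulVec_sub, sub_dotProduct, dotProduct_sub]
  ring

/-- For a graph Laplacian `L` and a coupling function `g`
satisfying the coupling assumption with `P`, `G`, `c`: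
`− Σᵢ Σⱼ Lᵢⱼ eᵢᵀ P g(xᵢ,xⱼ,t) ≤ − c Σᵢ Σⱼ Lᵢⱼ eᵢᵀ G eⱼ`. -/
theorem coupling_term_bound
    {n N : ℕ}
    (L : Matrix (Fin N) (Fin N) ℝ)
    (hLsym : L.IsSymm) (hLrow : ∀ i, ∑ j, L i j = 0)
    (hLoff : ∀ i j, i ≠ j → L i j ≤ 0)
    (P G : Matrix (Fin n) (Fin n) ℝ) (hGsym : G.IsSymm)
    (c : ℝ) (hc0 : 0 ≤ c)
    (g : (Fin n → ℝ) → (Fin n → ℝ) → ℝ → (Fin n → ℝ))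
    (hg : CouplingAssumption P G c g)
    (x : Fin N → (Fin n → ℝ)) (t : ℝ) (ht : 0 ≤ t)
    (xbar : Fin n → ℝ) (hxbar : xbar = (N : ℝ)⁻¹ • ∑ i, x i)
    (e : Fin N → (Fin n → ℝ)) (he : ∀ i, e i = x i - xbar) :
    -(∑ i, ∑ j, L i j * (e i ⬝ᵥ P.mulVec (g (x i) (x j) t)))
      ≤ -(c * ∑ i, ∑ j, L i j * (e i ⬝ᵥ G.mulVec (e j))) := by
  have hdiff : ∀ i j, e i - e j = x i - x j := fun i j => by rw [he, he, sub_sub_sub_cancel_right]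
  obtain ⟨hzero, hanti, hmono⟩ := hg
  have hcoupling := two_mul_sum_symm_mul hLsym fun i j => e i ⬝ᵥ P.mulVec (g (x i) (x j) t)
  have hquad := two_mul_sum_laplacian_mul_bilin hLsym hLrow G e
  have hle : ∑ i, ∑ j, L i j * (-(c * ((e i - e j) ⬝ᵥ G.mulVec (e i - e j)))) ≤
      ∑ i, ∑ j, L i j *
        (e i ⬝ᵥ P.mulVec (g (x i) (x j) t) + e j ⬝ᵥ P.mulVec (g (x j) (x i) t)) := by
    refine Finset.sum_le_sum fun i _ => Finset.sum_le_sum fun j _ => ?_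
    rcases eq_or_ne i j with rfl | hij
    · simp [hzero _ t ht]
    · refine mul_le_mul_of_nonpos_left ?_ (hLoff i j hij)
      have h := hmono (x i) (x j) t ht
      rw [← hdiff, ← hdiff, sub_dotProduct (e j)] at h
      rw [hanti (x j) (x i) t ht, mulVec_neg, dotProduct_neg]
      linarith
  have hfactor : ∑ i, ∑ j, L i j * (-(c * ((e i - e j) ⬝ᵥ G.mulVec (e i - e j)))) =
      c * -∑ i, ∑ j, L i j * ((e i - e j) ⬝ᵥ G.mulVec (e i - e j)) := by
    simp only [Finset.mul_sum, ← Finset.sum_neg_distrib]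
    refine Finset.sum_congr rfl fun i _ => Finset.sum_congr rfl fun j _ => ?_
    ring
  rw [hfactor, ← hquad, ← hcoupling] at hle
  linarith
end

section
/- Let L ∈ ℝᴺˣᴺ be the Laplacian of a connected undirected graph and let G ∈ ℝⁿˣⁿ be symmetric positive semidefinite. Let e ∈ ℝⁿᴺ be the stack of blocks e₁,…,e_N ∈ ℝⁿ with Σ_{i=1}^{N} eᵢ = 0. Then eᵀ (L ⊗ G) e ≥ λ₂(L) · λ_min(G) · ‖e‖², where λ₂(L) is the second-smallest eigenvalue of L and λ_min(G) the smallest eigenvalue of G. -/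
open Matrix MeasureTheory
open scoped Kronecker

theorem sum_sq_pos {k : Type*} [Fintype k] {v : k → ℝ} (hv : v ≠ 0) : 0 < ∑ i, (v i) ^ 2 := by
  obtain ⟨i, hi⟩ := Function.ne_iff.mp hv
  exact Finset.sum_pos' (fun _ _ => sq_nonneg _) ⟨i, Finset.mem_univ i, sq_pos_of_ne_zero hi⟩

/-- A Rayleigh quotient infimum over a set of vectors bounds the quadratic form on that set. -/
theorem sInf_rayleigh_mul_le {k : Type*} [Fintype k] {M : Matrix k k ℝ} {p : (k → ℝ) → Prop}
    (hM : ∀ v, 0 ≤ v ⬝ᵥ M.mulVec v) {v : k → ℝ} (hv : p v) :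
    sInf {r : ℝ | ∃ v : k → ℝ, v ≠ 0 ∧ p v ∧ v ⬝ᵥ M.mulVec v = r * ∑ i, (v i) ^ 2} *
      ∑ i, (v i) ^ 2 ≤ v ⬝ᵥ M.mulVec v := by
  by_cases h0 : v = 0
  · simp [h0]
  · rw [← le_div_iff₀ (sum_sq_pos h0)]
    refine csInf_le ⟨0, ?_⟩ ⟨v, h0, hv, (div_mul_cancel₀ _ (sum_sq_pos h0).ne').symm⟩
    rintro r ⟨w, hw, -, hr⟩
    exact nonneg_of_mul_nonneg_left (hr ▸ hM w) (sum_sq_pos hw)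

theorem lambdaMin_mul_le {n : ℕ} {G : Matrix (Fin n) (Fin n) ℝ}
    (hG : ∀ v, 0 ≤ v ⬝ᵥ G.mulVec v) (v : Fin n → ℝ) :
    lambdaMin G * ∑ i, (v i) ^ 2 ≤ v ⬝ᵥ G.mulVec v := by
  simpa [lambdaMin] using sInf_rayleigh_mul_le (p := fun _ => True) hG (v := v) trivial

theorem lambda2_mul_le {N : ℕ} {L : Matrix (Fin N) (Fin N) ℝ}
    (hL : ∀ v, 0 ≤ v ⬝ᵥ L.mulVec v) {v : Fin N → ℝ} (hv : ∑ i, v i = 0) :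
    lambda2 L * ∑ i, (v i) ^ 2 ≤ v ⬝ᵥ L.mulVec v :=
  sInf_rayleigh_mul_le (p := fun v => ∑ i, v i = 0) hL hv

theorem lambdaMin_nonneg {n : ℕ} {G : Matrix (Fin n) (Fin n) ℝ}
    (hG : ∀ v, 0 ≤ v ⬝ᵥ G.mulVec v) : 0 ≤ lambdaMin G := by
  refine Real.sInf_nonneg ?_
  rintro r ⟨w, hw, hr⟩
  exact nonneg_of_mul_nonneg_left (hr ▸ hG w) (sum_sq_pos hw)

theorem posSemidef_sub_lambdaMin_smul_one {n : ℕ} {G : Matrix (Fin n) (Fin n) ℝ}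
    (hG : G.PosSemidef) : (G - lambdaMin G • (1 : Matrix (Fin n) (Fin n) ℝ)).PosSemidef := by
  refine .of_dotProduct_mulVec_nonneg (hG.1.sub (isHermitian_one.smul (.all _))) fun v => ?_
  have h := lambdaMin_mul_le (fun v => by simpa using hG.dotProduct_mulVec_nonneg v) v
  simp only [star_trivial, sub_mulVec, smul_mulVec, one_mulVec, dotProduct_sub, dotProduct_smul,
    smul_eq_mul, sub_nonneg]
  simpa [dotProduct, pow_two] using h

/-- The quadratic form of `L ⊗ I` splits into one quadratic form of `L` per coordinate. -/
theorem dotProduct_kronecker_one_mulVec {m k : Type*} [Fintype m] [Fintype k] [DecidableEq k]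
    (L : Matrix m m ℝ) (x : m × k → ℝ) :
    x ⬝ᵥ (L ⊗ₖ (1 : Matrix k k ℝ)).mulVec x =
      ∑ j, (fun i => x (i, j)) ⬝ᵥ L.mulVec (fun i => x (i, j)) := by
  simp only [dotProduct, mulVec, Fintype.sum_prod_type, kroneckerMap_apply, one_apply, mul_ite,
    mul_one, mul_zero, ite_mul, zero_mul, Finset.sum_ite_eq, Finset.mem_univ, if_true]
  exact Finset.sum_comm

/-- For a connected-graph Laplacian `L` and a symmetric positive
semidefinite `G`, and a zero-sum stacked vector `e`:
`eᵀ (L ⊗ G) e ≥ λ₂(L) λ_min(G) ‖e‖²`. -/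
theorem kronecker_rayleigh_lower_bound
    {n N : ℕ} (hn : 0 < n) (hN : 2 ≤ N)
    (L : Matrix (Fin N) (Fin N) ℝ) (hL : IsLaplacianConnected L)
    (G : Matrix (Fin n) (Fin n) ℝ) (hG : G.PosSemidef)
    (e : Fin N → (Fin n → ℝ)) (hsum : ∑ i, e i = 0) :
    lambda2 L * lambdaMin G * (euclNorm (fun p : Fin N × Fin n => e p.1 p.2)) ^ 2
      ≤ (fun p : Fin N × Fin n => e p.1 p.2) ⬝ᵥ
          ((L ⊗ₖ G).mulVec (fun p : Fin N × Fin n => e p.1 p.2)) := by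
  obtain ⟨hsymm, hLnn, -, -⟩ := hL
  have hGnn : ∀ v, 0 ≤ v ⬝ᵥ G.mulVec v := fun v => by simpa using hG.dotProduct_mulVec_nonneg v
  have hLpsd : L.PosSemidef :=
    .of_dotProduct_mulVec_nonneg (by simpa [IsHermitian] using hsymm.eq)
      fun v => by simpa using hLnn v
  set x : Fin N × Fin n → ℝ := fun p => e p.1 p.2
  have hrem := (hLpsd.kronecker (posSemidef_sub_lambdaMin_smul_one hG)).dotProduct_mulVec_nonneg x
  have hsub : L ⊗ₖ (G - lambdaMin G • (1 : Matrix (Fin n) (Fin n) ℝ)) =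
      L ⊗ₖ G - lambdaMin G • (L ⊗ₖ (1 : Matrix (Fin n) (Fin n) ℝ)) := by
    rw [sub_eq_add_neg, kronecker_add, ← neg_smul, kronecker_smul, neg_smul, ← sub_eq_add_neg]
  rw [hsub, sub_mulVec, smul_mulVec, dotProduct_sub, dotProduct_smul,
    star_trivial, dotProduct_kronecker_one_mulVec, smul_eq_mul, sub_nonneg] at hrem
  refine le_trans ?_ hrem
  rw [euclNorm, Real.sq_sqrt (Finset.sum_nonneg fun _ _ => sq_nonneg _),
    Fintype.sum_prod_type_right, mul_comm (lambda2 L), mul_assoc, Finset.mul_sum]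
  refine mul_le_mul_of_nonneg_left (Finset.sum_le_sum fun j _ => ?_) (lambdaMin_nonneg hGnn)
  exact lambda2_mul_le hLnn (by simpa using congrFun hsum j)
end
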